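/- arXiv:2210.16026 — 2 statements merged into one kernel-verified Lean document; each statement's English description precedes it below -/
import Mathlib

section
/- A set K ⊆ D is relatively compact in the topology induced by d_{J1} if and only if (i) sup_{f∈K} ‖f‖∞ < +∞, and (ii) lim_{δ↓0} sup_{f∈K} ω'_δ(f) = 0. -/
open Set Filter Topology

noncomputable section

/-- The unit interval `[0,1] ⊆ ℝ`, as a type. -/
abbrev unitI : Type := ↥(Set.Icc (0:ℝ) 1)

/-- The point `0` of the unit interval. -/
def i0 : unitI := ⟨0, by norm_num⟩

/-- The point `1` of the unit interval. -/
def i1 : unitI := ⟨1, by norm_num⟩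

/-- A function `f : [0,1] → ℝ` is càdlàg if it is right-continuous at every point and
has a left limit at every point (both conditions being vacuous where the corresponding
one-sided neighbourhood filter is trivial). -/
def Cadlag (f : unitI → ℝ) : Prop :=
  (∀ t : unitI, Tendsto f (𝓝[>] t) (𝓝 (f t))) ∧
  (∀ t : unitI, ∃ L : ℝ, Tendsto f (𝓝[<] t) (𝓝 L))

/-- The Skorokhod space `D` of càdlàg functions `[0,1] → ℝ`. -/
def D : Type := {f : unitI → ℝ // Cadlag f}

/-- A time change: a strictly increasing bijection `λ : [0,1] → [0,1]`. -/
def TimeChange (l : unitI → unitI) : Prop := StrictMono l ∧ Function.Bijective l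

/-- The Skorokhod `J₁` metric
`d_{J1}(f,g) = inf_λ ( sup_t |f(λ t) - g t| + sup_t |λ t - t| )`. -/
def dJ1 (f g : D) : ℝ :=
  sInf {x : ℝ | ∃ l : unitI → unitI, TimeChange l ∧
    x = (⨆ t : unitI, |f.1 (l t) - g.1 t|) + ⨆ t : unitI, |(l t : ℝ) - (t : ℝ)|}


/-- The càdlàg modulus of continuity `ω'_δ(f)`: the infimum, over finite partitions
`0 = t₀ < t₁ < ⋯ < t_v = 1` with `t_i - t_{i-1} > δ`, of
`max_i sup_{s,u ∈ [t_{i-1}, t_i)} |f u - f s|`. -/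
def omegaP (δ : ℝ) (f : D) : ℝ :=
  sInf {x : ℝ | ∃ (v : ℕ) (t : Fin (v + 1) → unitI),
    t 0 = i0 ∧ t (Fin.last v) = i1 ∧
    (∀ i : Fin v, δ < (t i.succ : ℝ) - (t i.castSucc : ℝ)) ∧
    x = sSup {y : ℝ | ∃ (i : Fin v) (s u : unitI),
      t i.castSucc ≤ s ∧ s < t i.succ ∧ t i.castSucc ≤ u ∧ u < t i.succ ∧
      y = |f.1 u - f.1 s|}}

theorem aux_locate (v : ℕ) (t : ℕ → unitI) (x : unitI) (h0 : t 0 ≤ x) (h1 : x < t v) :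
    ∃ i, i < v ∧ t i ≤ x ∧ x < t (i + 1) := by
  induction v with
  | zero => exact absurd h1 (not_lt.2 h0)
  | succ n ih =>
    by_cases h : x < t n
    · obtain ⟨i, hi, h⟩ := ih h
      exact ⟨i, by omega, h⟩
    · exact ⟨n, by omega, not_lt.1 h, h1⟩

/-- A partition of mesh greater than `δ` with oscillations at most `ε`. -/
def NPart (δ ε : ℝ) (f : unitI → ℝ) (v : ℕ) (t : ℕ → unitI) : Prop :=
  t 0 = i0 ∧ t v = i1 ∧ (∀ i < v, δ < (t (i + 1) : ℝ) - (t i : ℝ)) ∧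
  ∀ i < v, ∀ s u : unitI, t i ≤ s → s < t (i + 1) → t i ≤ u → u < t (i + 1) → |f u - f s| ≤ ε

theorem i0_le (x : unitI) : i0 ≤ x := x.2.1

theorem le_i1 (x : unitI) : x ≤ i1 := x.2.2

theorem aux_osc_nonneg (f : D) (v : ℕ) (t : Fin (v + 1) → unitI) :
    0 ≤ sSup {y : ℝ | ∃ (i : Fin v) (s u : unitI),
      t i.castSucc ≤ s ∧ s < t i.succ ∧ t i.castSucc ≤ u ∧ u < t i.succ ∧
      y = |f.1 u - f.1 s|} := by
  apply Real.sSup_nonneg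
  rintro y ⟨i, s, u, -, -, -, -, rfl⟩
  exact abs_nonneg _

theorem omegaP_le_of_part {δ ε : ℝ} (hε : 0 ≤ ε) {f : D} {v : ℕ} {t : ℕ → unitI}
    (h : NPart δ ε f.1 v t) : omegaP δ f ≤ ε := by
  obtain ⟨h0, h1, h2, h3⟩ := h
  refine le_trans (csInf_le ?_ ⟨v, fun i => t i, by simpa using h0, by simpa using h1, ?_, rfl⟩) ?_
  · refine ⟨0, ?_⟩
    rintro x ⟨v, t, -, -, -, rfl⟩
    exact aux_osc_nonneg f v t
  · intro i
    simpa using h2 i i.2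
  · apply Real.sSup_le _ hε
    rintro y ⟨i, s, u, a, b, c, d, rfl⟩
    exact h3 i i.2 s u (by simpa using a) (by simpa using b) (by simpa using c) (by simpa using d)

theorem part_of_omegaP_lt {δ ε M : ℝ} (hδ : δ < 1) {f : D} (hM : ∀ t, |f.1 t| ≤ M)
    (h : omegaP δ f < ε) : ∃ v t, NPart δ ε f.1 v t := by
  obtain ⟨x, ⟨v, t, h0, h1, h2, rfl⟩, hx⟩ := exists_lt_of_csInf_lt (by
    refine ⟨_, 1, fun i => if i = 0 then i0 else i1, by simp, by simp, ?_, rfl⟩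
    intro i
    have : i = 0 := Subsingleton.elim _ _
    subst this
    simpa [i0, i1] using hδ) h
  refine ⟨v, fun i => t ⟨min i v, by omega⟩, ?_, ?_, ?_, ?_⟩
  · simpa using h0
  · simpa [Fin.last] using h1
  · intro i hi
    have := h2 ⟨i, hi⟩
    have e1 : min (i + 1) v = i + 1 := by omega
    have e2 : min i v = i := by omega
    simpa [e1, e2, Fin.succ, Fin.castSucc, Fin.castAdd, Fin.castLE] using this
  · intro i hi s u a b c d
    have e1 : min (i + 1) v = i + 1 := by omega
    have e2 : min i v = i := by omega
    refine le_trans (le_csSup (a := |f.1 u - f.1 s|) ?_ ?_) hx.le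
    · refine ⟨2 * M, ?_⟩
      rintro y ⟨i, s, u, -, -, -, -, rfl⟩
      have := hM s
      have := hM u
      rw [abs_le] at *
      constructor <;> linarith
    refine ⟨⟨i, hi⟩, s, u, ?_, ?_, ?_, ?_, rfl⟩
    · simpa [e1, e2, Fin.succ, Fin.castSucc, Fin.castAdd, Fin.castLE] using a
    · simpa [e1, e2, Fin.succ, Fin.castSucc, Fin.castAdd, Fin.castLE] using b
    · simpa [e1, e2, Fin.succ, Fin.castSucc, Fin.castAdd, Fin.castLE] using c
    · simpa [e1, e2, Fin.succ, Fin.castSucc, Fin.castAdd, Fin.castLE] using d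

theorem part_bdd {δ ε : ℝ} {f : unitI → ℝ} {v : ℕ} {t : ℕ → unitI}
    (h : NPart δ ε f v t) : ∃ M, ∀ x, |f x| ≤ M := by
  obtain ⟨h0, h1, h2, h3⟩ := h
  refine ⟨|f i1| + |ε| + ∑ i ∈ Finset.range v, |f (t i)|, fun x => ?_⟩
  have hs : 0 ≤ ∑ i ∈ Finset.range v, |f (t i)| := Finset.sum_nonneg fun _ _ => abs_nonneg _
  rcases (le_i1 x).lt_or_eq with hx | hx
  · obtain ⟨i, hi, a, b⟩ := aux_locate v t x (h0 ▸ i0_le x) (h1 ▸ hx)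
    have := h3 i hi (t i) x le_rfl (a.trans_lt b) a b
    have h4 : |f (t i)| ≤ ∑ i ∈ Finset.range v, |f (t i)| :=
      Finset.single_le_sum (f := fun i => |f (t i)|) (fun _ _ => abs_nonneg _)
        (Finset.mem_range.2 hi)
    have h5 := abs_sub_abs_le_abs_sub (f x) (f (t i))
    have := le_abs_self ε
    have := abs_nonneg (f i1)
    linarith
  · subst hx
    have := abs_nonneg ε
    linarith

/-- Finite set of points separating oscillations. -/
theorem cadlag_fin {f : unitI → ℝ} (hf : Cadlag f) {ε : ℝ} (hε : 0 < ε) :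
    ∃ S : Finset unitI, ∀ s u : unitI, s ≤ u → (∀ c ∈ S, ¬ (s < c ∧ c ≤ u)) →
      |f u - f s| ≤ ε := by
  have key : ∀ c : unitI, ∃ U ∈ 𝓝 c, ∃ S : Finset unitI, ∀ s u : unitI, s ∈ U → s ≤ u →
      (∀ c ∈ S, ¬ (s < c ∧ c ≤ u)) → |f u - f s| ≤ ε := by
    intro c
    obtain ⟨L, hL⟩ := hf.2 c
    have hR := hf.1 c
    have hL' : ∀ᶠ x in 𝓝[<] c, |f x - L| < ε / 2 := by
      have := Metric.tendsto_nhds.1 hL (ε / 2) (by linarith)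
      simpa [Real.dist_eq] using this
    have hR' : ∀ᶠ x in 𝓝[>] c, |f x - f c| < ε / 2 := by
      have := Metric.tendsto_nhds.1 hR (ε / 2) (by linarith)
      simpa [Real.dist_eq] using this
    rw [eventually_nhdsWithin_iff] at hL' hR'
    obtain ⟨r, hr, hb⟩ := Metric.eventually_nhds_iff.1 (hL'.and hR')
    have hr2 : 0 < r / 2 := by linarith
    let y : unitI := Set.projIcc 0 1 (by norm_num) ((c : ℝ) + r / 2)
    have hright : ∀ x : unitI, c ≤ x → (x < y ∨ x ≤ c) → |f x - f c| < ε / 2 := by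
      intro x hcx hxy
      rcases hcx.eq_or_lt with h | h
      · subst h
        simpa using hε
      · rcases hxy with hxy | hxy
        · refine (hb ?_).2 h
          have h1 : (x : ℝ) < c + r / 2 := by
            have : (x : ℝ) < (y : ℝ) := hxy
            have hy : (y : ℝ) = max 0 (min 1 ((c : ℝ) + r / 2)) := by
              simp [y, Set.projIcc]
            rw [hy] at this
            rcases lt_max_iff.1 this with h | h
            · exact absurd x.2.1 (not_le.2 h)
            · exact (lt_min_iff.1 h).2
          have h2 : (c : ℝ) < x := h
          rw [Subtype.dist_eq, Real.dist_eq, abs_lt]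
          constructor <;> linarith
        · exact absurd hxy (not_le.2 h)
    have hleft : ∀ x : unitI, x < c → dist x c < r → |f x - L| < ε / 2 :=
      fun x hx hd => (hb hd).1 hx
    by_cases hy1 : (c : ℝ) + r / 2 ≤ 1
    · have hyv : (y : ℝ) = c + r / 2 := by
        simp only [y, Set.projIcc]
        rw [min_eq_right hy1, max_eq_right (by have := c.2.1; linarith)]
      refine ⟨Metric.ball c (r / 2), Metric.ball_mem_nhds _ hr2, {c, y}, ?_⟩
      intro s u hs hsu hS
      have hs' : dist s c < r / 2 := hs
      have hsy : s < y := by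
        rw [Subtype.dist_eq, Real.dist_eq, abs_lt] at hs'
        show (s : ℝ) < y
        linarith
      have huy : u < y := by
        by_contra h
        exact hS y (by simp) ⟨hsy, not_lt.1 h⟩
      rcases lt_or_ge s c with hsc | hsc
      · have huc : u < c := by
          by_contra h
          exact hS c (by simp) ⟨hsc, not_lt.1 h⟩
        have h1 := hleft s hsc (by linarith)
        have h2 := hleft u huc (by
          rw [Subtype.dist_eq, Real.dist_eq, abs_lt] at *
          have a : (s : ℝ) ≤ u := hsu
          have b : (u : ℝ) < c := huc
          constructor <;> linarith)
        rw [abs_lt] at h1 h2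
        rw [abs_le]
        constructor <;> linarith
      · have h1 := hright s hsc (Or.inl hsy)
        have h2 := hright u (hsc.trans hsu) (Or.inl huy)
        rw [abs_lt] at h1 h2
        rw [abs_le]
        constructor <;> linarith
    · have hright' : ∀ x : unitI, c ≤ x → |f x - f c| < ε / 2 := by
        intro x hcx
        rcases hcx.eq_or_lt with h | h
        · subst h
          simpa using hε
        · refine (hb ?_).2 h
          have h2 : (c : ℝ) < x := h
          have := x.2.2
          rw [Subtype.dist_eq, Real.dist_eq, abs_lt]
          constructor <;> linarith
      refine ⟨Metric.ball c (r / 2), Metric.ball_mem_nhds _ hr2, {c}, ?_⟩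
      intro s u hs hsu hS
      have hs' : dist s c < r / 2 := hs
      rcases lt_or_ge s c with hsc | hsc
      · have huc : u < c := by
          by_contra h
          exact hS c (by simp) ⟨hsc, not_lt.1 h⟩
        have h1 := hleft s hsc (by linarith)
        have h2 := hleft u huc (by
          rw [Subtype.dist_eq, Real.dist_eq, abs_lt] at *
          have a : (s : ℝ) ≤ u := hsu
          have b : (u : ℝ) < c := huc
          constructor <;> linarith)
        rw [abs_lt] at h1 h2
        rw [abs_le]
        constructor <;> linarith
      · have h1 := hright' s hsc
        have h2 := hright' u (hsc.trans hsu)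
        rw [abs_lt] at h1 h2
        rw [abs_le]
        constructor <;> linarith
  choose U hU S hS using key
  obtain ⟨C, -, hC⟩ := (isCompact_univ (X := unitI)).elim_nhds_subcover U (fun x _ => hU x)
  refine ⟨C.biUnion S, fun s u hsu h => ?_⟩
  obtain ⟨c, hc, hsc⟩ := Set.mem_iUnion₂.1 (hC (Set.mem_univ s))
  exact hS c s u hsc hsu fun d hd => h d (Finset.mem_biUnion.2 ⟨c, hc, hd⟩)

theorem cadlag_part {f : unitI → ℝ} (hf : Cadlag f) {ε : ℝ} (hε : 0 < ε) :
    ∃ δ > 0, ∃ v t, NPart δ ε f v t := by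
  obtain ⟨S, hS⟩ := cadlag_fin hf hε
  let S' : Finset unitI := insert i0 (insert i1 S)
  have hne : S'.Nonempty := ⟨i0, by simp [S']⟩
  obtain ⟨v, hv⟩ : ∃ v, S'.card = v + 1 := ⟨S'.card - 1, by have := hne.card_pos; omega⟩
  let e := S'.orderEmbOfFin hv
  have hrange : ∀ c ∈ S', ∃ j, e j = c := by
    intro c hc
    have : c ∈ Set.range e := by
      rw [Finset.range_orderEmbOfFin]; exact hc
    exact this
  have he0 : e 0 = i0 := by
    obtain ⟨j, hj⟩ := hrange i0 (by simp [S'])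
    refine le_antisymm ?_ (i0_le _)
    rw [← hj]
    exact e.monotone (Fin.zero_le j)
  have he1 : e (Fin.last v) = i1 := by
    obtain ⟨j, hj⟩ := hrange i1 (by simp [S'])
    refine le_antisymm (le_i1 _) ?_
    rw [← hj]
    exact e.monotone (Fin.le_last j)
  let t : ℕ → unitI := fun i => e ⟨min i v, by omega⟩
  have hlt : ∀ i < v, t i < t (i + 1) := by
    intro i hi
    apply e.strictMono
    rw [Fin.mk_lt_mk]
    omega
  obtain ⟨δ, hδ, hgap⟩ : ∃ δ > 0, ∀ i < v, δ < (t (i + 1) : ℝ) - (t i : ℝ) := by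
    clear_value t
    clear he0 he1 hrange e hv
    induction v with
    | zero => exact ⟨1, one_pos, by simp⟩
    | succ n ih =>
      obtain ⟨δ, hδ, h⟩ := ih (fun i hi => hlt i (by omega))
      have h1 : 0 < (t (n + 1) : ℝ) - t n := sub_pos.2 (hlt n (by omega))
      refine ⟨min δ (((t (n + 1) : ℝ) - t n) / 2), lt_min hδ (by linarith), fun i hi => ?_⟩
      rcases Nat.lt_succ_iff_lt_or_eq.1 hi with h2 | h2
      · exact (min_le_left _ _).trans_lt (h i h2)
      · subst h2
        exact (min_le_right _ _).trans_lt (by linarith)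
  refine ⟨δ, hδ, v, t, ?_, ?_, hgap, ?_⟩
  · simpa [t] using he0
  · simpa [t, Fin.last] using he1
  · have main : ∀ i < v, ∀ s u : unitI, t i ≤ s → s ≤ u → u < t (i + 1) → |f u - f s| ≤ ε := by
      intro i hi s u a b c
      refine hS s u b ?_
      rintro d hd ⟨h1, h2⟩
      obtain ⟨j, hj⟩ := hrange d (by simp [S', hd])
      have h3 : t i < e j := by rw [hj]; exact a.trans_lt h1
      have h4 : e j < t (i + 1) := by rw [hj]; exact h2.trans_lt c
      have h5 := e.lt_iff_lt.1 h3
      have h6 := e.lt_iff_lt.1 h4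
      rw [Fin.lt_def] at h5 h6
      simp only at h5 h6
      omega
    intro i hi s u a b c d
    rcases le_total s u with h | h
    · exact main i hi s u a h d
    · rw [abs_sub_comm]
      exact main i hi u s c h b

theorem cadlag_of_part {f : unitI → ℝ}
    (h : ∀ ε > 0, ∃ δ > 0, ∃ v t, NPart δ ε f v t) : Cadlag f := by
  constructor
  · intro x
    rw [Metric.tendsto_nhds]
    intro ε hε
    obtain ⟨δ, hδ, v, t, h0, h1, h2, h3⟩ := h (ε / 2) (by linarith)
    rcases (le_i1 x).lt_or_eq with hx | hx
    · obtain ⟨i, hi, a, b⟩ := aux_locate v t x (h0 ▸ i0_le x) (h1 ▸ hx)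
      filter_upwards [Ioo_mem_nhdsGT b] with u hu
      have := h3 i hi x u a b (a.trans hu.1.le) hu.2
      rw [Real.dist_eq]
      linarith
    · filter_upwards [self_mem_nhdsWithin] with u hu
      exact absurd (le_i1 u) (not_le.2 (hx ▸ hu))
  · intro x
    rcases eq_or_neBot (𝓝[<] x) with hb | hb
    · exact ⟨0, by rw [hb]; exact tendsto_bot⟩
    · apply cauchy_map_iff_exists_tendsto.1
      rw [Metric.cauchy_iff]
      refine ⟨inferInstance, fun ε hε => ?_⟩
      obtain ⟨δ, hδ, v, t, h0, h1, h2, h3⟩ := h (ε / 2) (by linarith)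
      have hx0 : i0 < x := by
        refine lt_of_le_of_ne (i0_le x) ?_
        rintro rfl
        apply hb.ne
        have : Set.Iio i0 = ∅ := by
          ext y; simpa using i0_le y
        rw [this, nhdsWithin_empty]
      obtain ⟨i, hi, a, b⟩ : ∃ i, i < v ∧ t i < x ∧ x ≤ t (i + 1) := by
        have hxv : x ≤ t v := h1 ▸ le_i1 x
        rw [← h0] at hx0
        clear h1 h2 h3
        induction v with
        | zero => exact absurd hx0 (not_lt.2 hxv)
        | succ n ih =>
          by_cases h : x ≤ t n
          · obtain ⟨i, hi, h⟩ := ih h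
            exact ⟨i, by omega, h⟩
          · exact ⟨n, by omega, not_le.1 h, hxv⟩
      refine ⟨f '' Ioo (t i) x, image_mem_map (Ioo_mem_nhdsLT a), ?_⟩
      rintro _ ⟨y, hy, rfl⟩ _ ⟨z, hz, rfl⟩
      have := h3 i hi z y hz.1.le (hz.2.trans_le b) hy.1.le (hy.2.trans_le b)
      rw [Real.dist_eq]
      linarith

theorem cadlag_bdd (f : D) : ∃ M, ∀ x, |f.1 x| ≤ M := by
  obtain ⟨δ, -, v, t, h⟩ := cadlag_part f.2 one_pos
  exact part_bdd h

theorem dJ1_nonneg (f g : D) : 0 ≤ dJ1 f g := by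
  apply Real.sInf_nonneg
  rintro x ⟨l, -, rfl⟩
  exact add_nonneg (Real.iSup_nonneg fun _ => abs_nonneg _) (Real.iSup_nonneg fun _ => abs_nonneg _)

theorem dJ1_le {f g : D} {a b : ℝ} (l : unitI → unitI) (hl : TimeChange l)
    (ha : ∀ t, |f.1 (l t) - g.1 t| ≤ a) (hb : ∀ t, |(l t : ℝ) - t| ≤ b) : dJ1 f g ≤ a + b := by
  have : Nonempty unitI := ⟨i0⟩
  refine le_trans ?_ (add_le_add (ciSup_le ha) (ciSup_le hb))
  unfold dJ1
  refine csInf_le ?_ ⟨l, hl, rfl⟩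
  refine ⟨0, ?_⟩
  rintro x ⟨l, -, rfl⟩
  exact add_nonneg (Real.iSup_nonneg fun _ => abs_nonneg _) (Real.iSup_nonneg fun _ => abs_nonneg _)

theorem dJ1_lt {f g : D} {ε : ℝ} (h : dJ1 f g < ε) : ∃ l : unitI → unitI, TimeChange l ∧
    (∀ t, |f.1 (l t) - g.1 t| < ε) ∧ ∀ t, |(l t : ℝ) - t| < ε := by
  obtain ⟨x, ⟨l, hl, rfl⟩, hx⟩ := exists_lt_of_csInf_lt
    (by exact ⟨_, id, ⟨strictMono_id, Function.bijective_id⟩, rfl⟩) h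
  obtain ⟨M, hM⟩ := cadlag_bdd f
  obtain ⟨N, hN⟩ := cadlag_bdd g
  have p1 : 0 ≤ ⨆ t : unitI, |f.1 (l t) - g.1 t| := Real.iSup_nonneg fun _ => abs_nonneg _
  have p2 : 0 ≤ ⨆ t : unitI, |(l t : ℝ) - t| := Real.iSup_nonneg fun _ => abs_nonneg _
  refine ⟨l, hl, fun t => ?_, fun t => ?_⟩
  · have := le_ciSup (f := fun t : unitI => |f.1 (l t) - g.1 t|) (by
      refine ⟨M + N, ?_⟩
      rintro _ ⟨t, rfl⟩
      exact (abs_sub _ _).trans (add_le_add (hM _) (hN _))) t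
    exact lt_of_le_of_lt this (by linarith)
  · have := le_ciSup (f := fun t : unitI => |(l t : ℝ) - t|) (by
      refine ⟨1, ?_⟩
      rintro _ ⟨t, rfl⟩
      have := t.2.1
      have := t.2.2
      have := (l t).2.1
      have := (l t).2.2
      simp only
      rw [abs_le]
      constructor <;> linarith) t
    exact lt_of_le_of_lt this (by linarith)

theorem timeChange_i0 {l : unitI → unitI} (hl : TimeChange l) : l i0 = i0 := by
  obtain ⟨x, hx⟩ := hl.2.2 i0
  exact le_antisymm ((hl.1.monotone (i0_le x)).trans_eq hx) (i0_le _)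

theorem timeChange_i1 {l : unitI → unitI} (hl : TimeChange l) : l i1 = i1 := by
  obtain ⟨x, hx⟩ := hl.2.2 i1
  exact le_antisymm (le_i1 _) (hx.symm.le.trans (hl.1.monotone (le_i1 x)))

theorem aux_sep {v : ℕ} {T : ℕ → unitI} {δ : ℝ} (hδ : 0 < δ)
    (hgap : ∀ i < v, δ ≤ (T (i + 1) : ℝ) - T i) (i j : ℕ) (hij : i < j) (hj : j ≤ v) :
    δ ≤ (T j : ℝ) - T i := by
  induction j with
  | zero => omega
  | succ n ih =>
    have h1 := hgap n (by omega)
    rcases Nat.lt_succ_iff_lt_or_eq.1 hij with h | h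
    · have := ih h (by omega)
      linarith
    · subst h
      exact h1

theorem exists_timeChange {v : ℕ} {T s : ℕ → unitI} {δ η : ℝ} (hδ : 0 < δ) (hη : 0 ≤ η)
    (hηδ : 4 * η ≤ δ) (hT0 : T 0 = i0) (hTv : T v = i1) (hs0 : s 0 = i0) (hsv : s v = i1)
    (hgap : ∀ i < v, δ ≤ (T (i + 1) : ℝ) - T i) (hclose : ∀ i ≤ v, |(s i : ℝ) - T i| ≤ η) :
    ∃ l : unitI → unitI, TimeChange l ∧ (∀ i ≤ v, l (T i) = s i) ∧ ∀ x, |(l x : ℝ) - x| ≤ η := by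
  classical
  let p : ℝ → ℝ := fun x => if h : ∃ i, i ≤ v ∧ (T i : ℝ) = x then
    (s h.choose : ℝ) - T h.choose else 0
  have hsep : ∀ i j, i ≤ v → j ≤ v → i ≠ j → δ ≤ |(T i : ℝ) - T j| := by
    intro i j hi hj hij
    rcases lt_or_gt_of_ne hij with h | h
    · rw [abs_sub_comm]
      exact (aux_sep hδ hgap i j h hj).trans (le_abs_self _)
    · exact (aux_sep hδ hgap j i h hi).trans (le_abs_self _)
  have hp : ∀ i ≤ v, p (T i) = (s i : ℝ) - T i := by
    intro i hi
    have h : ∃ j, j ≤ v ∧ (T j : ℝ) = T i := ⟨i, hi, rfl⟩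
    have h2 : h.choose = i := by
      by_contra hne
      have := hsep _ _ h.choose_spec.1 hi hne
      rw [h.choose_spec.2] at this
      simp at this
      linarith
    simp only [p]
    rw [dif_pos h, h2]
  have hLip : LipschitzOnWith (1 / 2) p {x | ∃ i, i ≤ v ∧ (T i : ℝ) = x} := by
    apply LipschitzOnWith.of_dist_le_mul
    rintro _ ⟨i, hi, rfl⟩ _ ⟨j, hj, rfl⟩
    rw [hp i hi, hp j hj, Real.dist_eq, Real.dist_eq]
    by_cases hij : i = j
    · subst hij; simp
    · have h1 := hsep i j hi hj hij
      have h2 := hclose i hi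
      have h3 := hclose j hj
      have h4 : |(s i : ℝ) - T i - (s j - T j)| ≤ 2 * η := by
        refine (abs_sub _ _).trans ?_
        linarith
      push_cast
      linarith
  obtain ⟨q, hq, hpq⟩ := hLip.extend_real
  let c : ℝ → ℝ := fun x => max (-η) (min η (q x))
  have hcb : ∀ x, |c x| ≤ η := fun x => by
    rw [abs_le]
    exact ⟨le_max_left _ _, max_le (by linarith) (min_le_left _ _)⟩
  have hcl : ∀ x y, |c x - c y| ≤ 1 / 2 * |x - y| := by
    intro x y
    have h1 := hq.dist_le_mul x y
    rw [Real.dist_eq, Real.dist_eq] at h1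
    push_cast at h1
    refine le_trans ?_ h1
    refine (abs_max_sub_max_le_max _ _ _ _).trans ?_
    simp only [sub_self, abs_zero]
    refine max_le (abs_nonneg _) ?_
    refine (abs_min_sub_min_le_max _ _ _ _).trans ?_
    simp
  have hcT : ∀ i ≤ v, c (T i) = (s i : ℝ) - T i := by
    intro i hi
    have h1 : q (T i) = (s i : ℝ) - T i := by
      rw [← hp i hi]; exact (hpq ⟨i, hi, rfl⟩).symm
    have h2 := abs_le.1 (hclose i hi)
    simp only [c]
    rw [h1, min_eq_right h2.2, max_eq_right h2.1]
  let m : ℝ → ℝ := fun x => x + c x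
  have hm : StrictMono m := by
    intro x y hxy
    have := hcl x y
    rw [abs_sub_comm x y, abs_of_pos (sub_pos.2 hxy)] at this
    have := (abs_le.1 this).2
    simp only [m]
    linarith
  have hmc : Continuous m := by
    have hqc := hq.continuous
    simp only [m, c]
    fun_prop
  have hm0 : m 0 = 0 := by
    have := hcT 0 (Nat.zero_le _)
    rw [hT0, hs0] at this
    simp only [i0, sub_self] at this
    simp [m, this]
  have hm1 : m 1 = 1 := by
    have := hcT v le_rfl
    rw [hTv, hsv] at this
    simp only [i1, sub_self] at this
    simp [m, this]
  let l : unitI → unitI := fun x => ⟨m x, by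
    constructor
    · exact hm0.symm.le.trans (hm.monotone x.2.1)
    · have := hm.monotone x.2.2
      rwa [hm1] at this⟩
  refine ⟨l, ⟨fun x y hxy => hm hxy, ⟨?_, ?_⟩⟩, ?_, ?_⟩
  · exact (show StrictMono l from fun x y hxy => hm hxy).injective
  · intro y
    have := intermediate_value_Icc (zero_le_one (α := ℝ)) hmc.continuousOn
    rw [hm0, hm1] at this
    obtain ⟨x, hx, hxy⟩ := this y.2
    exact ⟨⟨x, hx⟩, Subtype.ext hxy⟩
  · intro i hi
    apply Subtype.ext
    show (T i : ℝ) + c (T i) = s i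
    rw [hcT i hi]; ring
  · intro x
    show |(x : ℝ) + c x - x| ≤ η
    rw [add_sub_cancel_left]
    exact hcb x

theorem part_count {δ ε : ℝ} {f : unitI → ℝ} {v : ℕ} {t : ℕ → unitI} (hδ : 0 < δ)
    (h : NPart δ ε f v t) : v ≤ ⌊1 / δ⌋₊ := by
  obtain ⟨h0, h1, h2, -⟩ := h
  have : ∀ i ≤ v, (i : ℝ) * δ ≤ t i := by
    intro i
    induction i with
    | zero => intro _; simpa using (t 0).2.1
    | succ n ih =>
      intro hn
      have := ih (by omega)
      have := h2 n (by omega)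
      push_cast
      linarith
  have h3 := this v le_rfl
  apply Nat.le_floor
  rw [le_div_iff₀ hδ]
  exact h3.trans (t v).2.2

theorem NPart.mono {δ δ' ε : ℝ} {f : unitI → ℝ} {v : ℕ} {t : ℕ → unitI} (hδ : δ' ≤ δ)
    (h : NPart δ ε f v t) : NPart δ' ε f v t :=
  ⟨h.1, h.2.1, fun i hi => hδ.trans_lt (h.2.2.1 i hi), h.2.2.2⟩

theorem forward_bdd (K : Set D)
    (hK : ∀ F : ℕ → D, (∀ n, F n ∈ K) → ∃ f : D, ∃ φ : ℕ → ℕ, StrictMono φ ∧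
        Tendsto (fun n => dJ1 (F (φ n)) f) atTop (𝓝 0)) :
    ∃ M : ℝ, ∀ f ∈ K, ∀ t : unitI, |f.1 t| ≤ M := by
  by_contra! hcon
  choose F hF t ht using fun n : ℕ => hcon n
  obtain ⟨f, φ, hφ, hlim⟩ := hK F hF
  obtain ⟨M, hM⟩ := cadlag_bdd f
  obtain ⟨n, hn1, hn2⟩ := ((hlim.eventually (gt_mem_nhds one_pos)).and
    (eventually_ge_atTop ⌈M + 1⌉₊)).exists
  obtain ⟨l, hl, h1, -⟩ := dJ1_lt hn1
  obtain ⟨x, hx⟩ := hl.2.2 (t (φ n))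
  have h2 := h1 x
  rw [hx] at h2
  have h3 := ht (φ n)
  have h4 : (n : ℝ) ≤ φ n := by exact_mod_cast hφ.le_apply
  have h5 : M + 1 ≤ n := Nat.ceil_le.1 hn2
  have h6 := hM x
  have h7 := abs_sub_abs_le_abs_sub ((F (φ n)).1 (t (φ n))) (f.1 x)
  linarith

theorem forward_part (K : Set D)
    (hK : ∀ F : ℕ → D, (∀ n, F n ∈ K) → ∃ f : D, ∃ φ : ℕ → ℕ, StrictMono φ ∧
        Tendsto (fun n => dJ1 (F (φ n)) f) atTop (𝓝 0)) {ε : ℝ} (hε : 0 < ε) :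
    ∃ δ > 0, ∀ f ∈ K, ∃ v t, NPart δ ε f.1 v t := by
  by_contra! hcon
  choose F hF ht using fun n : ℕ => hcon (1 / ((n : ℝ) + 1)) (by positivity)
  obtain ⟨f, φ, hφ, hlim⟩ := hK F hF
  obtain ⟨δ, hδ, v, t, h0, h1, h2, h3⟩ := cadlag_part f.2 (ε := ε / 3) (by linarith)
  have hlim2 : Tendsto (fun n : ℕ => 1 / ((φ n : ℝ) + 1)) atTop (𝓝 0) :=
    tendsto_one_div_add_atTop_nhds_zero_nat.comp hφ.tendsto_atTop
  have hη : 0 < min (ε / 3) (δ / 3) := by positivity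
  obtain ⟨n, hn1, hn2⟩ := ((hlim.eventually (gt_mem_nhds hη)).and
    (hlim2.eventually (gt_mem_nhds (show 0 < δ / 3 by positivity)))).exists
  obtain ⟨l, hl, h4, h5⟩ := dJ1_lt hn1
  refine ht (φ n) v (fun i => l (t i)) ⟨?_, ?_, ?_, ?_⟩
  · simp only [h0, timeChange_i0 hl]
  · simp only [h1, timeChange_i1 hl]
  · intro i hi
    have a := h2 i hi
    have b := abs_lt.1 ((h5 (t i)).trans_le (min_le_right _ _))
    have c := abs_lt.1 ((h5 (t (i + 1))).trans_le (min_le_right _ _))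
    simp only at hn2 ⊢
    linarith [b.1, b.2, c.1, c.2]
  · intro i hi s u a b c d
    obtain ⟨s, rfl⟩ := hl.2.2 s
    obtain ⟨u, rfl⟩ := hl.2.2 u
    have h6 := h3 i hi s u (hl.1.le_iff_le.1 a) (hl.1.lt_iff_lt.1 b) (hl.1.le_iff_le.1 c)
      (hl.1.lt_iff_lt.1 d)
    have h7 := abs_lt.1 ((h4 s).trans_le (min_le_left _ _))
    have h8 := abs_lt.1 ((h4 u).trans_le (min_le_left _ _))
    rw [abs_le] at h6 ⊢
    constructor <;> linarith [h6.1, h6.2, h7.1, h7.2, h8.1, h8.2]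

theorem backward (F : ℕ → D) (M : ℝ) (hM : ∀ n t, |(F n).1 t| ≤ M)
    (hF : ∀ ε > 0, ∃ δ > 0, ∀ n, ∃ v t, NPart δ ε (F n).1 v t) :
    ∃ f : D, ∃ φ : ℕ → ℕ, StrictMono φ ∧ Tendsto (fun n => dJ1 (F (φ n)) f) atTop (𝓝 0) := by
  classical
  let ε : ℕ → ℝ := fun k => 1 / ((k : ℝ) + 1)
  have hε : ∀ k, 0 < ε k := fun k => by simp only [ε]; positivity
  have hε0 : Tendsto ε atTop (𝓝 0) := tendsto_one_div_add_atTop_nhds_zero_nat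
  have hanti : Antitone ε := fun a b hab => by
    simp only [ε]
    have : (a : ℝ) ≤ b := by exact_mod_cast hab
    gcongr
  clear_value ε
  choose δ hδ hpart using fun k => hF (ε k) (hε k)
  choose v t hvt using hpart
  -- extraction
  let X : ℕ → (ℕ → ℕ) × (ℕ → ℕ → unitI) × (ℕ → ℕ → ℝ) := fun n =>
    (fun k => v k n, fun k i => t k n i, fun k i => (F n).1 (t k n i))
  have hcomp : IsCompact ((Set.univ.pi fun k => Set.Iic ⌊1 / δ k⌋₊) ×ˢ
      ((Set.univ : Set (ℕ → ℕ → unitI)) ×ˢ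
        (Set.univ.pi fun _ : ℕ => Set.univ.pi fun _ : ℕ => Set.Icc (-M) M))) := by
    refine IsCompact.prod (isCompact_univ_pi fun k => (Set.finite_Iic _).isCompact)
      (IsCompact.prod isCompact_univ
        (isCompact_univ_pi fun _ => isCompact_univ_pi fun _ => isCompact_Icc))
  obtain ⟨⟨V, T, A⟩, -, φ, hφ, hX⟩ := hcomp.tendsto_subseq (x := X) (by
    intro n
    refine ⟨fun k _ => part_count (hδ k) (hvt k n), Set.mem_univ _, fun k _ i _ => ?_⟩
    exact abs_le.1 (hM n _))
  have hV' : Tendsto (fun n => (fun k => v k (φ n))) atTop (𝓝 V) :=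
    (continuous_fst.tendsto _).comp hX
  have hT' : Tendsto (fun n => (fun k i => t k (φ n) i)) atTop (𝓝 T) :=
    ((continuous_fst.comp continuous_snd).tendsto _).comp hX
  have hA' : Tendsto (fun n => (fun k i => (F (φ n)).1 (t k (φ n) i))) atTop (𝓝 A) :=
    ((continuous_snd.comp continuous_snd).tendsto _).comp hX
  have hV : ∀ k, ∀ᶠ n in atTop, v k (φ n) = V k := fun k => by
    have := tendsto_pi_nhds.1 hV' k
    rwa [nhds_discrete, tendsto_pure] at this
  have hT : ∀ k i, Tendsto (fun n => t k (φ n) i) atTop (𝓝 (T k i)) := fun k i =>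
    tendsto_pi_nhds.1 (tendsto_pi_nhds.1 hT' k) i
  have hA : ∀ k i, Tendsto (fun n => (F (φ n)).1 (t k (φ n) i)) atTop (𝓝 (A k i)) := fun k i =>
    tendsto_pi_nhds.1 (tendsto_pi_nhds.1 hA' k) i
  clear hX hV' hT' hA' hcomp
  have hP : ∀ k, ∀ᶠ n in atTop, NPart (δ k) (ε k) (F (φ n)).1 (V k) (t k (φ n)) := fun k => by
    filter_upwards [hV k] with n hn
    rw [← hn]; exact hvt k (φ n)
  have hT0 : ∀ k, T k 0 = i0 := fun k => by
    refine tendsto_nhds_unique (hT k 0) (tendsto_const_nhds.congr' ?_)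
    filter_upwards [hP k] with n hn
    exact hn.1.symm
  have hT1 : ∀ k, T k (V k) = i1 := fun k => by
    refine tendsto_nhds_unique (hT k (V k)) (tendsto_const_nhds.congr' ?_)
    filter_upwards [hP k] with n hn
    exact hn.2.1.symm
  have hTc : ∀ k i, Tendsto (fun n => (t k (φ n) i : ℝ)) atTop (𝓝 (T k i : ℝ)) := fun k i =>
    (continuous_subtype_val.tendsto _).comp (hT k i)
  have hgap : ∀ k, ∀ i < V k, δ k ≤ (T k (i + 1) : ℝ) - T k i := fun k i hi => by
    refine ge_of_tendsto ((hTc k (i + 1)).sub (hTc k i)) ?_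
    filter_upwards [hP k] with n hn
    exact (hn.2.2.1 i hi).le
  have hA1 : ∀ k, Tendsto (fun n => (F (φ n)).1 i1) atTop (𝓝 (A k (V k))) := fun k => by
    refine (hA k (V k)).congr' ?_
    filter_upwards [hP k] with n hn
    rw [hn.2.1]
  -- comparison of the limit step functions
  have hmid : ∀ k, ∀ i < V k, ∀ u, T k i < u → u < T k (i + 1) →
      ∀ᶠ n in atTop, |(F (φ n)).1 u - (F (φ n)).1 (t k (φ n) i)| ≤ ε k := by
    intro k i hi u h1 h2
    filter_upwards [hP k, (hT k i).eventually (gt_mem_nhds h1),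
      (hT k (i + 1)).eventually (lt_mem_nhds h2)] with n hn a b
    exact hn.2.2.2 i hi _ u le_rfl (a.trans b) a.le b
  have hcmp : ∀ k m i j, i < V k → j < V m → ∀ x : unitI, T k i ≤ x → x < T k (i + 1) →
      T m j ≤ x → x < T m (j + 1) → |A k i - A m j| ≤ ε k + ε m := by
    intro k m i j hi hj x a b c d
    obtain ⟨u, hu1, hu2⟩ := exists_between (lt_min b d)
    have e1 := hmid k i hi u (a.trans_lt hu1) (hu2.trans_le (min_le_left _ _))
    have e2 := hmid m j hj u (c.trans_lt hu1) (hu2.trans_le (min_le_right _ _))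
    refine le_of_tendsto ((hA k i).sub (hA m j)).abs ?_
    filter_upwards [e1, e2] with n h1 h2
    rw [abs_le] at *
    constructor <;> linarith [h1.1, h1.2, h2.1, h2.2]
  have hidx : ∀ k (x : unitI), ∃ i, (x < i1 → i < V k ∧ T k i ≤ x ∧ x < T k (i + 1)) ∧
      (x = i1 → i = V k) := by
    intro k x
    rcases (le_i1 x).lt_or_eq with hx | hx
    · obtain ⟨i, hi⟩ := aux_locate (V k) (T k) x (hT0 k ▸ i0_le x) (hT1 k ▸ hx)
      exact ⟨i, fun _ => hi, fun h => absurd h hx.ne⟩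
    · exact ⟨V k, fun h => absurd hx h.ne, fun _ => rfl⟩
  choose idx hidx1 hidx2 using hidx
  have hg : ∀ k m x, |A k (idx k x) - A m (idx m x)| ≤ ε k + ε m := by
    intro k m x
    rcases (le_i1 x).lt_or_eq with hx | hx
    · obtain ⟨a, b, c⟩ := hidx1 k x hx
      obtain ⟨a', b', c'⟩ := hidx1 m x hx
      exact hcmp k m _ _ a a' x b c b' c'
    · rw [hidx2 k x hx, hidx2 m x hx, tendsto_nhds_unique (hA1 k) (hA1 m), sub_self, abs_zero]
      exact (add_pos (hε k) (hε m)).le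
  have hlim : ∀ x, ∃ y, Tendsto (fun k => A k (idx k x)) atTop (𝓝 y) := by
    intro x
    apply cauchySeq_tendsto_of_complete
    refine cauchySeq_of_le_tendsto_0 (fun N => ε N + ε N) ?_ (by simpa using hε0.add hε0)
    intro n m N hn hm
    rw [Real.dist_eq]
    exact (hg n m x).trans (add_le_add (hanti hn) (hanti hm))
  choose f hf using hlim
  have hgf : ∀ k x, |A k (idx k x) - f x| ≤ ε k := by
    intro k x
    have h1 : Tendsto (fun m => ε k + ε m) atTop (𝓝 (ε k)) := by
      simpa using (tendsto_const_nhds (x := ε k)).add hε0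
    exact le_of_tendsto_of_tendsto' ((tendsto_const_nhds.sub (hf x)).abs) h1 (fun m => hg k m x)
  have hH : ∀ k, ∀ i < V k, ∀ x, T k i ≤ x → x < T k (i + 1) → |A k i - f x| ≤ 3 * ε k := by
    intro k i hi x a b
    obtain ⟨a', b', c'⟩ := hidx1 k x (b.trans_le (le_i1 _))
    have h1 := hcmp k k _ _ hi a' x a b b' c'
    have h2 := hgf k x
    rw [abs_le] at *
    constructor <;> linarith [h1.1, h1.2, h2.1, h2.2]
  have hcad : Cadlag f := by
    apply cadlag_of_part
    intro e he
    obtain ⟨k, hk⟩ := (hε0.eventually (gt_mem_nhds (show 0 < e / 6 by linarith))).exists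
    refine ⟨δ k / 2, half_pos (hδ k), V k, T k, hT0 k, hT1 k, fun i hi => ?_, ?_⟩
    · have := hgap k i hi
      linarith [hδ k]
    · intro i hi s u a b c d
      have h1 := hH k i hi s a b
      have h2 := hH k i hi u c d
      rw [abs_le] at *
      constructor <;> linarith [h1.1, h1.2, h2.1, h2.2]
  refine ⟨⟨f, hcad⟩, φ, hφ, ?_⟩
  rw [Metric.tendsto_nhds]
  intro e he
  obtain ⟨k, hk⟩ := (hε0.eventually (gt_mem_nhds (show 0 < e / 6 by linarith))).exists
  have hη : 0 < min (δ k / 4) (ε k) := lt_min (by linarith [hδ k]) (hε k)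
  have e1 : ∀ᶠ n in atTop, ∀ i ∈ Finset.range (V k + 1),
      |(t k (φ n) i : ℝ) - T k i| < min (δ k / 4) (ε k) := by
    rw [Filter.eventually_all_finset]
    intro i _
    exact Metric.tendsto_nhds.1 (hTc k i) _ hη
  have e2 : ∀ᶠ n in atTop, ∀ i ∈ Finset.range (V k + 1),
      |(F (φ n)).1 (t k (φ n) i) - A k i| < ε k := by
    rw [Filter.eventually_all_finset]
    intro i _
    exact Metric.tendsto_nhds.1 (hA k i) _ (hε k)
  filter_upwards [e1, e2, hP k] with n h1 h2 h3
  obtain ⟨p0, p1, p2, p3⟩ := h3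
  obtain ⟨l, hl, hl1, hl2⟩ := exists_timeChange (v := V k) (T := T k) (s := t k (φ n)) (hδ k)
    hη.le (by linarith [min_le_left (δ k / 4) (ε k)]) (hT0 k) (hT1 k) p0 p1 (hgap k)
    (fun i hi => (h1 i (by simp; omega)).le)
  have h5 : dJ1 (F (φ n)) ⟨f, hcad⟩ ≤ 5 * ε k + ε k := by
    refine dJ1_le l hl ?_ (fun x => (hl2 x).trans (min_le_right _ _))
    intro x
    show |(F (φ n)).1 (l x) - f x| ≤ 5 * ε k
    rcases (le_i1 x).lt_or_eq with hx | hx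
    · obtain ⟨i, hi, a, b⟩ := aux_locate (V k) (T k) x (hT0 k ▸ i0_le x) (hT1 k ▸ hx)
      have a' := hl.1.monotone a
      have b' := hl.1 b
      rw [hl1 i hi.le] at a'
      rw [hl1 (i + 1) hi] at b'
      have q1 := p3 i hi _ (l x) le_rfl (a'.trans_lt b') a' b'
      have q2 := h2 i (by simp; omega)
      have q3 := hH k i hi x a b
      rw [abs_le] at *
      rw [abs_lt] at *
      constructor <;> linarith [q1.1, q1.2, q2.1, q2.2, q3.1, q3.2]
    · have q3 := hgf k x
      rw [hidx2 k x hx] at q3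
      have q2 := h2 (V k) (by simp)
      rw [p1] at q2
      rw [hx, timeChange_i1 hl, ← hx] at *
      have := hε k
      rw [abs_le] at *
      rw [abs_lt] at *
      constructor <;> linarith [q2.1, q2.2, q3.1, q3.2]
  have h6 := dJ1_nonneg (F (φ n)) ⟨f, hcad⟩
  rw [Real.dist_eq, sub_zero]
  exact abs_lt.2 ⟨by linarith, by linarith⟩

/-- A set `K ⊆ D` is relatively compact for the `J₁`-topology (every
sequence in `K` has a subsequence converging in `d_{J1}` to an element of `D`) iff
(i) `sup_{f ∈ K} ‖f‖_∞ < ∞` and (ii) `lim_{δ ↓ 0} sup_{f ∈ K} ω'_δ(f) = 0`. -/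
theorem relatively_compact_J1_iff (K : Set D) :
    (∀ F : ℕ → D, (∀ n, F n ∈ K) → ∃ f : D, ∃ φ : ℕ → ℕ, StrictMono φ ∧
        Tendsto (fun n => dJ1 (F (φ n)) f) atTop (𝓝 0)) ↔
      ((∃ M : ℝ, ∀ f ∈ K, ∀ t : unitI, |f.1 t| ≤ M) ∧
        Tendsto (fun δ : ℝ => ⨆ f ∈ K, ENNReal.ofReal (omegaP δ f))
          (𝓝[>] (0:ℝ)) (𝓝 0)) := by
  constructor
  · intro hK
    refine ⟨forward_bdd K hK, ?_⟩
    rw [ENNReal.tendsto_nhds_zero]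
    intro ε hε
    obtain ⟨r, hr0, hr1⟩ : ∃ r : ℝ, 0 < r ∧ ENNReal.ofReal r ≤ ε := by
      by_cases h : ε = ⊤
      · exact ⟨1, one_pos, h ▸ le_top⟩
      · exact ⟨ε.toReal, ENNReal.toReal_pos hε.ne' h, ENNReal.ofReal_toReal_le⟩
    obtain ⟨δ, hδ, h⟩ := forward_part K hK hr0
    filter_upwards [Ioo_mem_nhdsGT hδ] with d hd
    refine iSup₂_le fun f hf => ?_
    obtain ⟨v, t, hp⟩ := h f hf
    exact (ENNReal.ofReal_le_ofReal (omegaP_le_of_part hr0.le (hp.mono hd.2.le))).trans hr1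
  · rintro ⟨⟨M, hM⟩, hlim⟩ F hF
    refine backward F M (fun n => hM _ (hF n)) ?_
    intro ε hε
    rw [ENNReal.tendsto_nhds_zero] at hlim
    obtain ⟨δ, hδ, h1⟩ := ((hlim (ENNReal.ofReal (ε / 2)) (by simpa using hε)).and
      (Ioo_mem_nhdsGT one_pos)).exists
    refine ⟨δ, h1.1, fun n => part_of_omegaP_lt h1.2 (hM _ (hF n)) ?_⟩
    have h2 := (le_iSup₂ (f := fun f (_ : f ∈ K) => ENNReal.ofReal (omegaP δ f)) (F n) (hF n)).trans hδ
    rw [ENNReal.ofReal_le_ofReal_iff (by linarith)] at h2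
    linarith
end
end

section
/- The function d_{M1}(f,g) := inf { ‖λ_f − λ_g‖∞ + ‖ρ_f − ρ_g‖∞ : (λ_f, ρ_f) a parametric representation of f, (λ_g, ρ_g) a parametric representation of g } is a metric on D. -/
open Set Filter Topology

noncomputable section

/-- The completed graph `Γ(f) ⊆ [0,1] × ℝ` of a càdlàg function `f`: the points
`(t, z)` with `z = α f(t-) + (1-α) f(t)` for some `α ∈ [0,1]`, where `f(t-)` denotes
the left limit of `f` at `t` (with `f(0-) = f(0)`). -/
def Gamma (f : D) : Set (unitI × ℝ) :=
  {p | ∃ α ∈ Set.Icc (0:ℝ) 1,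
    p.2 = α * Function.leftLim f.1 p.1 + (1 - α) * f.1 p.1}

/-- The order on the completed graph: `(t₁, z₁) ≤ (t₂, z₂)` iff `t₁ < t₂`, or `t₁ = t₂`
and `|z₁ - f(t₁-)| ≤ |z₂ - f(t₂-)|`. -/
def graphLE (f : D) (p q : unitI × ℝ) : Prop :=
  p.1 < q.1 ∨ (p.1 = q.1 ∧
    |p.2 - Function.leftLim f.1 p.1| ≤ |q.2 - Function.leftLim f.1 q.1|)

/-- A parametric representation of `f ∈ D`: a continuous surjection
`(λ, ρ) : [0,1] → Γ(f)` which is nondecreasing for the order on `Γ(f)`. -/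
def ParamRep (f : D) (u : unitI → unitI × ℝ) : Prop :=
  Continuous u ∧ Set.range u = Gamma f ∧
    ∀ s t : unitI, s ≤ t → graphLE f (u s) (u t)

/-- The Skorokhod `M₁` metric
`d_{M1}(f,g) = inf { ‖λ_f - λ_g‖_∞ + ‖ρ_f - ρ_g‖_∞ }`, the infimum being over all
parametric representations `(λ_f, ρ_f)` of `f` and `(λ_g, ρ_g)` of `g`. -/
def dM1 (f g : D) : ℝ :=
  sInf {x : ℝ | ∃ u v : unitI → unitI × ℝ, ParamRep f u ∧ ParamRep g v ∧
    x = (⨆ t : unitI, |((u t).1 : ℝ) - ((v t).1 : ℝ)|) +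
      ⨆ t : unitI, |(u t).2 - (v t).2|}

open Function

lemma tendsto_leftLim' (f : D) (t : unitI) :
    Tendsto f.1 (𝓝[<] t) (𝓝 (leftLim f.1 t)) :=
  tendsto_leftLim_of_tendsto (f.2.2 t)

lemma near_aux (f : D) {S : Set unitI} (hS : IsOpen S) (t : unitI) {c : ℝ}
    (h : Tendsto f.1 (𝓝[S] t) (𝓝 c)) {ε : ℝ} (hε : 0 < ε) :
    ∀ᶠ s in 𝓝[S] t, ∀ z, (s, z) ∈ Gamma f → |z - c| ≤ ε := by
  have h1 : ∀ᶠ s in 𝓝[S] t, f.1 s ∈ Metric.closedBall c ε :=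
    h (Metric.closedBall_mem_nhds c hε)
  have h2 := eventually_eventually_nhdsWithin.2 h1
  filter_upwards [h1, h2, self_mem_nhdsWithin] with s hs1 hs2 hsS z hz
  rw [hS.nhdsWithin_eq hsS] at hs2
  have hl : leftLim f.1 s ∈ Metric.closedBall c ε := by
    rcases eq_or_neBot (𝓝[<] s) with hb | hb
    · rw [leftLim_eq_of_eq_bot _ hb]; exact hs1
    · exact Metric.isClosed_closedBall.mem_of_tendsto (tendsto_leftLim' f s)
        (nhdsWithin_le_nhds hs2)
  obtain ⟨α, hα, hz⟩ := hz
  have := (convex_closedBall c ε) hl hs1 hα.1 (sub_nonneg.2 hα.2) (by ring)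
  simp only [smul_eq_mul] at this
  dsimp only at hz
  rw [← hz, Metric.mem_closedBall, Real.dist_eq] at this
  exact this

/-- Along a filter on the graph whose first coordinate goes to `t` within an open set,
the second coordinate tends to the corresponding one-sided limit. -/
lemma tendsto_snd_aux (f : D) {S : Set unitI} (hS : IsOpen S) (t : unitI) {c : ℝ}
    (h : Tendsto f.1 (𝓝[S] t) (𝓝 c)) {U : Filter (unitI × ℝ)} (hU : ∀ᶠ p in U, p ∈ Gamma f)
    (h1 : Tendsto Prod.fst U (𝓝[S] t)) : Tendsto Prod.snd U (𝓝 c) := by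
  rw [Metric.nhds_basis_closedBall.tendsto_right_iff]
  intro ε hε
  filter_upwards [hU, h1.eventually (near_aux f hS t h hε)] with p hp h2
  rw [Metric.mem_closedBall, Real.dist_eq]
  exact h2 p.2 hp

lemma left_mem (f : D) (t : unitI) : (t, leftLim f.1 t) ∈ Gamma f :=
  ⟨1, by simp, by simp⟩

lemma right_mem (f : D) (t : unitI) : (t, f.1 t) ∈ Gamma f :=
  ⟨0, by simp, by simp⟩

lemma ultra_cases (t : unitI) (U : Ultrafilter (unitI × ℝ)) (h : Tendsto Prod.fst (U : Filter (unitI × ℝ)) (𝓝 t)) :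
    Tendsto Prod.fst (U : Filter (unitI × ℝ)) (𝓝[<] t) ∨ Tendsto Prod.fst (U : Filter (unitI × ℝ)) (𝓝[>] t) ∨
      ∀ᶠ p in (U : Filter (unitI × ℝ)), p.1 = t := by
  have : ∀ᶠ p in (U : Filter (unitI × ℝ)), p.1 < t ∨ t < p.1 ∨ p.1 = t :=
    Eventually.of_forall fun p => by
      rcases lt_trichotomy p.1 t with h | h | h <;> simp [h]
  rcases Ultrafilter.eventually_or.1 this with h1 | h1
  · left; exact tendsto_nhdsWithin_iff.2 ⟨h, h1⟩
  · rcases Ultrafilter.eventually_or.1 h1 with h1 | h1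
    · right; left; exact tendsto_nhdsWithin_iff.2 ⟨h, h1⟩
    · right; right; exact h1

lemma isCompact_fibre (f : D) (t : unitI) :
    IsCompact ((fun α : ℝ => (t, α * leftLim f.1 t + (1 - α) * f.1 t)) '' Icc 0 1) :=
  isCompact_Icc.image (by fun_prop)

lemma isCompact_Gamma (f : D) : IsCompact (Gamma f) := by
  rw [isCompact_iff_ultrafilter_le_nhds']
  intro U hU
  obtain ⟨t, -, ht⟩ := isCompact_univ.ultrafilter_le_nhds (U.map Prod.fst) (by simp)
  have ht : Tendsto Prod.fst (U : Filter (unitI × ℝ)) (𝓝 t) := ht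
  rcases ultra_cases t U ht with h | h | h
  · exact ⟨_, left_mem f t, by
      have := ht.prodMk_nhds (tendsto_snd_aux f isOpen_Iio t (tendsto_leftLim' f t) hU h)
      exact this⟩
  · exact ⟨_, right_mem f t, by
      have := ht.prodMk_nhds (tendsto_snd_aux f isOpen_Ioi t (f.2.1 t) hU h)
      exact this⟩
  · have : ((fun α : ℝ => (t, α * leftLim f.1 t + (1 - α) * f.1 t)) '' Icc 0 1) ∈ U := by
      filter_upwards [h, hU] with p hp hpU
      obtain ⟨α, hα, h2⟩ := hpU
      exact ⟨α, hα, by rw [← hp]; exact Prod.ext rfl h2.symm⟩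
    obtain ⟨x, ⟨α, hα, rfl⟩, hx⟩ := isCompact_iff_ultrafilter_le_nhds'.1 (isCompact_fibre f t) U this
    exact ⟨_, ⟨α, hα, rfl⟩, hx⟩

/-- Progress of the point `p` through the jump at `s`. -/
def theta (f : D) (s : unitI) (p : unitI × ℝ) : ℝ :=
  if p.1 < s then 0 else if s < p.1 then 1 else |p.2 - leftLim f.1 s| / |f.1 s - leftLim f.1 s|

lemma theta_lt (f : D) {s : unitI} {p : unitI × ℝ} (h : p.1 < s) : theta f s p = 0 := by
  simp [theta, h]
lemma theta_gt (f : D) {s : unitI} {p : unitI × ℝ} (h : s < p.1) : theta f s p = 1 := by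
  simp [theta, h, not_lt.2 h.le]
lemma theta_eq (f : D) {s : unitI} {p : unitI × ℝ} (h : p.1 = s) :
    theta f s p = |p.2 - leftLim f.1 s| / |f.1 s - leftLim f.1 s| := by
  simp [theta, h]

/-- the position in the fibre -/
lemma abs_fibre (f : D) {t : unitI} {z : ℝ} (h : (t, z) ∈ Gamma f) :
    |z - leftLim f.1 t| ≤ |f.1 t - leftLim f.1 t| := by
  obtain ⟨α, hα, h⟩ := h
  dsimp only at h
  rw [show z - leftLim f.1 t = (1 - α) * (f.1 t - leftLim f.1 t) by rw [h]; ring, abs_mul,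
    abs_of_nonneg (sub_nonneg.2 hα.2)]
  exact mul_le_of_le_one_left (abs_nonneg _) (by linarith [hα.1])

lemma fibre_inj (f : D) {t : unitI} {z w : ℝ} (hz : (t, z) ∈ Gamma f) (hw : (t, w) ∈ Gamma f)
    (h : |z - leftLim f.1 t| = |w - leftLim f.1 t|) : z = w := by
  obtain ⟨α, hα, h1⟩ := hz
  obtain ⟨β, hβ, h2⟩ := hw
  dsimp only at h1 h2
  rw [show z - leftLim f.1 t = (1 - α) * (f.1 t - leftLim f.1 t) by rw [h1]; ring, abs_mul,
    show w - leftLim f.1 t = (1 - β) * (f.1 t - leftLim f.1 t) by rw [h2]; ring, abs_mul,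
    abs_of_nonneg (sub_nonneg.2 hα.2), abs_of_nonneg (sub_nonneg.2 hβ.2)] at h
  rcases mul_eq_mul_right_iff.1 h with h | h
  · have : α = β := by linarith
    rw [h1, h2, this]
  · have : f.1 t = leftLim f.1 t := by linarith [abs_eq_zero.1 h]
    rw [h1, h2, this]; ring

lemma theta_nonneg (f : D) (s : unitI) (p : unitI × ℝ) : 0 ≤ theta f s p := by
  unfold theta; split_ifs
  · exact le_rfl
  · exact zero_le_one
  · positivity

lemma theta_le_one (f : D) (s : unitI) {p : unitI × ℝ} (hp : p ∈ Gamma f) : theta f s p ≤ 1 := by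
  rcases lt_trichotomy p.1 s with h | h | h
  · rw [theta_lt f h]; exact zero_le_one
  · rw [theta_eq f h]; subst h
    exact div_le_one_of_le₀ (abs_fibre f hp) (abs_nonneg _)
  · rw [theta_gt f h]

lemma theta_mono (f : D) (s : unitI) {p q : unitI × ℝ} (hp : p ∈ Gamma f)
    (h : graphLE f p q) : theta f s p ≤ theta f s q := by
  rcases lt_trichotomy p.1 s with h1 | h1 | h1
  · rw [theta_lt f h1]; exact theta_nonneg _ _ _
  · rcases h with h | h
    · rw [theta_gt f (h1 ▸ h : s < q.1)]; exact theta_le_one f s hp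
    · rw [theta_eq f h1, theta_eq f (h.1 ▸ h1)]
      have := h.2
      rw [← h.1, h1] at this
      gcongr
  · rw [theta_gt f (p := q)]; exact theta_le_one f s hp
    rcases h with h | h
    · exact h1.trans h
    · exact h.1 ▸ h1

lemma theta_cont (f : D) (s : unitI) (hs : f.1 s ≠ leftLim f.1 s) :
    ContinuousOn (theta f s) (Gamma f) := by
  intro p hp
  rw [ContinuousWithinAt, tendsto_iff_ultrafilter]
  intro U hU
  have hmem : ∀ᶠ q in (U : Filter (unitI × ℝ)), q ∈ Gamma f := hU self_mem_nhdsWithin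
  have hU' : (U : Filter (unitI × ℝ)) ≤ 𝓝 p := hU.trans nhdsWithin_le_nhds
  have h1 : Tendsto Prod.fst (U : Filter (unitI × ℝ)) (𝓝 p.1) := (continuous_fst.tendsto p).mono_left hU'
  have h2 : Tendsto Prod.snd (U : Filter (unitI × ℝ)) (𝓝 p.2) := (continuous_snd.tendsto p).mono_left hU'
  rcases lt_trichotomy p.1 s with h | h | h
  · rw [theta_lt f h]
    refine tendsto_const_nhds.congr' ?_
    filter_upwards [h1.eventually (gt_mem_nhds h)] with q hq
    rw [theta_lt f hq]
  · rw [h] at h1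
    rw [theta_eq f h]
    rcases ultra_cases s U h1 with h3 | h3 | h3
    · have := tendsto_nhds_unique h2 (tendsto_snd_aux f isOpen_Iio s (tendsto_leftLim' f s) hmem h3)
      rw [this, sub_self, abs_zero, zero_div]
      refine tendsto_const_nhds.congr' ?_
      filter_upwards [(tendsto_nhdsWithin_iff.1 h3).2] with q hq
      rw [theta_lt f hq]
    · have := tendsto_nhds_unique h2 (tendsto_snd_aux f isOpen_Ioi s (f.2.1 s) hmem h3)
      rw [this, div_self (abs_ne_zero.2 (sub_ne_zero.2 hs))]
      refine tendsto_const_nhds.congr' ?_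
      filter_upwards [(tendsto_nhdsWithin_iff.1 h3).2] with q hq
      rw [theta_gt f hq]
    · refine (((h2.sub_const _).abs).div_const _).congr' ?_
      filter_upwards [h3] with q hq
      rw [theta_eq f hq]
  · rw [theta_gt f h]
    refine tendsto_const_nhds.congr' ?_
    filter_upwards [h1.eventually (lt_mem_nhds h)] with q hq
    rw [theta_gt f hq]

def jumps (f : D) : Set unitI := {s | f.1 s ≠ leftLim f.1 s}

lemma mid_mem (f : D) (s : unitI) : (s, (leftLim f.1 s + f.1 s) / 2) ∈ Gamma f :=
  ⟨1/2, by constructor <;> norm_num, by dsimp only; ring⟩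

lemma theta_Ioo (f : D) {s : unitI} {p : unitI × ℝ} (h : theta f s p ∈ Ioo (0:ℝ) 1) : p.1 = s := by
  rcases lt_trichotomy p.1 s with h1 | h1 | h1
  · rw [theta_lt f h1] at h; simp at h
  · exact h1
  · rw [theta_gt f h1] at h; simp at h

lemma jumps_countable (f : D) : (jumps f).Countable := by
  refine Set.PairwiseDisjoint.countable_of_isOpen (α := Gamma f)
    (s := fun s => {p : Gamma f | theta f s p ∈ Ioo (0:ℝ) 1}) ?_ ?_ ?_
  · intro s _ t _ hst
    refine Set.disjoint_left.2 fun p h1 h2 => hst ?_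
    rw [← theta_Ioo f h1, ← theta_Ioo f h2]
  · intro s hs
    exact isOpen_Ioo.preimage (continuousOn_iff_continuous_domRestrict.1 (theta_cont f s hs))
  · intro s hs
    refine ⟨⟨_, mid_mem f s⟩, ?_⟩
    have : |f.1 s - leftLim f.1 s| ≠ 0 := abs_ne_zero.2 (sub_ne_zero.2 hs)
    have h2 : theta f s (s, (leftLim f.1 s + f.1 s) / 2) = 1/2 := by
      rw [theta_eq f (s := s) (p := (s, (leftLim f.1 s + f.1 s) / 2)) rfl]
      dsimp only
      rw [show (leftLim f.1 s + f.1 s) / 2 - leftLim f.1 s = (1/2) * (f.1 s - leftLim f.1 s) by ring,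
        abs_mul, mul_div_assoc, div_self this]
      norm_num
    show theta f s (s, (leftLim f.1 s + f.1 s) / 2) ∈ Ioo (0:ℝ) 1
    rw [h2]; constructor <;> norm_num

lemma graphLE_total (f : D) (p q : unitI × ℝ) : graphLE f p q ∨ graphLE f q p := by
  unfold graphLE
  rcases lt_trichotomy p.1 q.1 with h | h | h
  · simp [h]
  · rcases le_total |p.2 - leftLim f.1 p.1| |q.2 - leftLim f.1 q.1| with h' | h'
    · exact Or.inl (Or.inr ⟨h, h'⟩)
    · exact Or.inr (Or.inr ⟨h.symm, h'⟩)
  · simp [h]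

lemma graphLE_antisymm (f : D) {p q : unitI × ℝ} (hp : p ∈ Gamma f) (hq : q ∈ Gamma f)
    (h : graphLE f p q) (h' : graphLE f q p) : p = q := by
  obtain ⟨t, z⟩ := p
  obtain ⟨t', w⟩ := q
  unfold graphLE at h h'
  dsimp only at h h'
  have ht : t = t' := by
    rcases h with h | h
    · rcases h' with h' | h'
      · exact absurd h (not_lt.2 h'.le)
      · exact h'.1.symm
    · exact h.1
  subst ht
  simp only [lt_irrefl, false_or, true_and] at h h'
  rw [fibre_inj f hp hq (le_antisymm h h')]

lemma not_graphLE (f : D) {p q : unitI × ℝ} : ¬ graphLE f q p ↔ p.1 < q.1 ∨ (p.1 = q.1 ∧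
    |p.2 - leftLim f.1 p.1| < |q.2 - leftLim f.1 q.1|) := by
  unfold graphLE
  rcases lt_trichotomy p.1 q.1 with h | h | h
  · simp [h, not_lt.2 h.le, h.ne']
  · simp [h]
  · simp [h, not_lt.2 h.le, h.ne']

lemma graph_dense (f : D) {p q : unitI × ℝ} (hp : p ∈ Gamma f) (hq : q ∈ Gamma f)
    (h : ¬ graphLE f q p) : ∃ r ∈ Gamma f, ¬ graphLE f r p ∧ ¬ graphLE f q r := by
  simp only [not_graphLE] at h ⊢
  rcases h with h | h
  · obtain ⟨t, ht1, ht2⟩ := exists_between h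
    exact ⟨(t, f.1 t), right_mem f t, Or.inl ht1, Or.inl ht2⟩
  · obtain ⟨t, z⟩ := p
    obtain ⟨t', w⟩ := q
    obtain ⟨h1, h2⟩ := h
    dsimp only at h1 h2
    subst h1
    obtain ⟨α, hα, hz⟩ := hp
    obtain ⟨β, hβ, hw⟩ := hq
    dsimp only at hz hw
    refine ⟨(t, (z + w) / 2), ⟨(α + β) / 2, ?_, ?_⟩, Or.inr ⟨rfl, ?_⟩, Or.inr ⟨rfl, ?_⟩⟩
    · constructor <;> linarith [hα.1, hα.2, hβ.1, hβ.2]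
    · dsimp only; rw [hz, hw]; ring
    all_goals
      dsimp only
      rw [show z - leftLim f.1 t = (1 - α) * (f.1 t - leftLim f.1 t) by rw [hz]; ring, abs_mul,
        show w - leftLim f.1 t = (1 - β) * (f.1 t - leftLim f.1 t) by rw [hw]; ring, abs_mul,
        abs_of_nonneg (sub_nonneg.2 hα.2), abs_of_nonneg (sub_nonneg.2 hβ.2)] at h2
      have e : |(z + w) / 2 - leftLim f.1 t| = (1 - (α + β) / 2) * |f.1 t - leftLim f.1 t| := by
        rw [show (z + w) / 2 - leftLim f.1 t = (1 - (α + β) / 2) * (f.1 t - leftLim f.1 t) by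
          rw [hz, hw]; ring, abs_mul, abs_of_nonneg]
        linarith [hα.2, hβ.2]
      rw [e]
    · rw [show z - leftLim f.1 t = (1 - α) * (f.1 t - leftLim f.1 t) by rw [hz]; ring, abs_mul,
        abs_of_nonneg (sub_nonneg.2 hα.2)]
      linarith
    · rw [show w - leftLim f.1 t = (1 - β) * (f.1 t - leftLim f.1 t) by rw [hw]; ring, abs_mul,
        abs_of_nonneg (sub_nonneg.2 hβ.2)]
      linarith

lemma exists_phi (f : D) : ∃ φ : Gamma f → ℝ, Continuous φ ∧
    ∀ p q : Gamma f, ¬ graphLE f q p → φ p < φ q := by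
  have := (jumps_countable f).to_subtype
  have := Encodable.ofCountable (jumps f)
  obtain ⟨w, hw, c, hc, -⟩ := posSumOfEncodable zero_lt_one (jumps f)
  have hsum : ∀ p : Gamma f, Summable fun s : jumps f => w s * theta f s p := fun p =>
    hc.summable.of_nonneg_of_le (fun s => mul_nonneg (hw s).le (theta_nonneg _ _ _))
      (fun s => mul_le_of_le_one_right (hw s).le (theta_le_one f s p.2))
  refine ⟨fun p => (p.1.1 : ℝ) + ∑' s : jumps f, w s * theta f s p, ?_, ?_⟩
  · refine (continuous_subtype_val.comp (continuous_fst.comp continuous_subtype_val)).add ?_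
    refine continuous_tsum (u := w) (fun s => ?_) hc.summable ?_
    · exact continuous_const.mul (continuousOn_iff_continuous_domRestrict.1 (theta_cont f s s.2))
    · intro s p
      rw [Real.norm_eq_abs, abs_of_nonneg (mul_nonneg (hw s).le (theta_nonneg _ _ _))]
      exact mul_le_of_le_one_right (hw s).le (theta_le_one f s p.2)
  · intro p q h
    have hpq : graphLE f p q := (graphLE_total f p q).resolve_right h
    have hle : ∀ s : jumps f, w s * theta f s p ≤ w s * theta f s q := fun s =>
      mul_le_mul_of_nonneg_left (theta_mono f s p.2 hpq) (hw s).le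
    rcases (not_graphLE f).1 h with h1 | ⟨h1, h2⟩
    · exact add_lt_add_of_lt_of_le h1 ((hsum p).tsum_le_tsum hle (hsum q))
    · have hJ : f.1 q.1.1 ≠ leftLim f.1 q.1.1 := by
        intro hJ
        have := abs_fibre f (t := q.1.1) (z := q.1.2) q.2
        rw [hJ, sub_self, abs_zero] at this
        exact absurd (h2.trans_le this) (not_lt.2 (abs_nonneg _))
      refine add_lt_add_of_le_of_lt (by rw [h1]) ?_
      refine Summable.tsum_lt_tsum (i := (⟨q.1.1, hJ⟩ : jumps f)) hle ?_ (hsum p) (hsum q)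
      refine mul_lt_mul_of_pos_left ?_ (hw _)
      rw [theta_eq f h1, theta_eq f rfl]
      rw [h1] at h2
      exact div_lt_div_of_pos_right h2 (abs_pos.2 (sub_ne_zero.2 hJ))

lemma exists_homeo (f : D) : ∃ ψ : Gamma f ≃ₜ unitI, ∀ p q : Gamma f,
    graphLE f p q ↔ ψ p ≤ ψ q := by
  obtain ⟨φ, hφ, hlt⟩ := exists_phi f
  have : CompactSpace (Gamma f) := isCompact_iff_compactSpace.1 (isCompact_Gamma f)
  have hne : Nonempty (Gamma f) := ⟨⟨_, right_mem f i0⟩⟩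
  have hle : ∀ p q : Gamma f, graphLE f p q ↔ φ p ≤ φ q := by
    intro p q
    constructor
    · intro h
      by_contra h'
      have : p = q := by
        refine Subtype.ext (graphLE_antisymm f p.2 q.2 h ?_)
        by_contra h2
        exact h' (hlt p q h2).le
      rw [this] at h'; exact h' le_rfl
    · intro h
      by_contra h'
      exact absurd (hlt q p h') (not_lt.2 h)
  have hinj : Injective φ := fun p q h =>
    Subtype.ext (graphLE_antisymm f p.2 q.2 ((hle p q).2 h.le) ((hle q p).2 h.ge))
  have hK : IsCompact (range φ) := isCompact_range hφ
  obtain ⟨A, hA⟩ := hK.exists_isLeast (range_nonempty φ)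
  obtain ⟨B, hB⟩ := hK.exists_isGreatest (range_nonempty φ)
  have hAB : A < B := by
    have h1 : φ ⟨_, right_mem f i0⟩ < φ ⟨_, right_mem f i1⟩ := by
      refine hlt _ _ ((not_graphLE f).2 (Or.inl ?_))
      show (0:ℝ) < 1
      norm_num
    exact (hA.2 (mem_range_self _)).trans_lt (h1.trans_le (hB.2 (mem_range_self _)))
  have hmem : ∀ p, φ p ∈ Icc A B := fun p => ⟨hA.2 (mem_range_self _), hB.2 (mem_range_self _)⟩
  have hsurj : ∀ c ∈ Icc A B, ∃ p, φ p = c := by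
    intro c hc
    by_contra! hno
    obtain ⟨a, ⟨⟨p, rfl⟩, ha2⟩, ha3⟩ := (hK.inter_right (isClosed_Iic (a := c))).exists_isGreatest
      ⟨A, hA.1, hc.1⟩
    obtain ⟨b, ⟨⟨q, rfl⟩, hb2⟩, hb3⟩ := (hK.inter_right (isClosed_Ici (a := c))).exists_isLeast
      ⟨B, hB.1, hc.2⟩
    have h1 : φ p < c := lt_of_le_of_ne ha2 (hno p)
    have h2 : c < φ q := lt_of_le_of_ne hb2 (hno q).symm
    obtain ⟨r, hr, hr1, hr2⟩ := graph_dense f p.2 q.2 (by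
      rw [hle]; exact not_le.2 (h1.trans h2))
    have h3 := hlt p ⟨r, hr⟩ hr1
    have h4 := hlt ⟨r, hr⟩ q hr2
    rcases le_total (φ ⟨r, hr⟩) c with h | h
    · exact absurd h3 (not_lt.2 (ha3 ⟨mem_range_self _, h⟩))
    · exact absurd h4 (not_lt.2 (hb3 ⟨mem_range_self _, h⟩))
  let Φ : Gamma f → Icc A B := fun p => ⟨φ p, hmem p⟩
  have hΦ : Continuous Φ := hφ.subtype_mk hmem
  have hbij : Bijective Φ := ⟨fun p q h => hinj (congrArg Subtype.val h), fun c => by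
    obtain ⟨p, hp⟩ := hsurj c c.2
    exact ⟨p, Subtype.ext hp⟩⟩
  let E := Continuous.homeoOfEquivCompactToT2 (f := Equiv.ofBijective Φ hbij) hΦ
  refine ⟨E.trans (iccHomeoI A B hAB), fun p q => ?_⟩
  rw [hle, ← Subtype.coe_le_coe]
  simp only [Homeomorph.trans_apply, iccHomeoI_apply_coe]
  rw [div_le_div_iff_of_pos_right (sub_pos.2 hAB), sub_le_sub_iff_right]
  rfl

lemma paramRep_exists (f : D) : ∃ u, ParamRep f u := by
  obtain ⟨ψ, hψ⟩ := exists_homeo f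
  refine ⟨fun t => (ψ.symm t : unitI × ℝ), continuous_subtype_val.comp ψ.symm.continuous, ?_, ?_⟩
  · ext p
    constructor
    · rintro ⟨t, rfl⟩; exact (ψ.symm t).2
    · intro hp; exact ⟨ψ ⟨p, hp⟩, by simp⟩
  · intro s t hst
    rw [hψ]; simpa using hst

lemma ParamRep.mem {f : D} {u : unitI → unitI × ℝ} (hu : ParamRep f u) (t : unitI) :
    u t ∈ Gamma f := hu.2.1 ▸ mem_range_self t

lemma ParamRep.comp {f : D} {u : unitI → unitI × ℝ} (hu : ParamRep f u) {a : unitI → unitI}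
    (h1 : Continuous a) (h2 : Surjective a) (h3 : Monotone a) : ParamRep f (fun t => u (a t)) := by
  refine ⟨hu.1.comp h1, ?_, fun s t h => hu.2.2 _ _ (h3 h)⟩
  rw [← hu.2.1]
  exact h2.range_comp u

lemma reparam_aux {φ : unitI → unitI} (h1 : Continuous φ) (h2 : Surjective φ)
    (h3 : Monotone φ) {ε : ℝ} (hε : 0 < ε) (hε1 : ε < 1) :
    ∃ b : unitI → unitI, Continuous b ∧ Surjective b ∧ Monotone b ∧
      ∀ t, |(φ (b t) : ℝ) - t| ≤ ε := by
  have hm : ∀ s : unitI, (1 - ε) * (φ s : ℝ) + ε * s ∈ Icc (0:ℝ) 1 := by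
    intro s
    have := (φ s).2; have := s.2
    simp only [mem_Icc] at *
    constructor
    · nlinarith
    · nlinarith
  let χ : unitI → unitI := fun s => ⟨(1 - ε) * (φ s : ℝ) + ε * s, hm s⟩
  have hχ : StrictMono χ := by
    intro s t hst
    have h4 : (φ s : ℝ) ≤ φ t := h3 hst.le
    have h5 : (s : ℝ) < t := hst
    show (1 - ε) * (φ s : ℝ) + ε * s < (1 - ε) * (φ t : ℝ) + ε * t
    nlinarith
  have hχc : Continuous χ := Continuous.subtype_mk (by fun_prop) hm
  have h0 : (φ i0 : ℝ) = 0 := by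
    obtain ⟨s, hs⟩ := h2 i0
    have : (φ i0 : ℝ) ≤ φ s := h3 (show (0:ℝ) ≤ s from s.2.1)
    rw [hs] at this
    exact le_antisymm this (φ i0).2.1
  have h1' : (φ i1 : ℝ) = 1 := by
    obtain ⟨s, hs⟩ := h2 i1
    have : (φ s : ℝ) ≤ φ i1 := h3 (show (s:ℝ) ≤ 1 from s.2.2)
    rw [hs] at this
    exact le_antisymm (φ i1).2.2 this
  have hχs : Surjective χ := by
    intro c
    refine mem_range_of_exists_le_of_exists_ge hχc ⟨i0, ?_⟩ ⟨i1, ?_⟩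
    · show (1 - ε) * (φ i0 : ℝ) + ε * (0:ℝ) ≤ c
      rw [h0]; linarith [c.2.1]
    · show (c : ℝ) ≤ (1 - ε) * (φ i1 : ℝ) + ε * (1:ℝ)
      rw [h1']; linarith [c.2.2]
  let o := hχ.orderIsoOfSurjective χ hχs
  refine ⟨o.symm, o.symm.continuous, o.symm.surjective, o.symm.monotone, fun t => ?_⟩
  have : χ (o.symm t) = t := o.apply_symm_apply t
  have h6 : (t : ℝ) = (1 - ε) * (φ (o.symm t) : ℝ) + ε * (o.symm t : ℝ) :=
    (congrArg Subtype.val this).symm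
  have h7 := (φ (o.symm t)).2
  have h8 := (o.symm t).2
  simp only [mem_Icc] at h7 h8
  rw [h6, abs_le]
  constructor <;> nlinarith

lemma ParamRep.approx {g : D} {v v' : unitI → unitI × ℝ} (hv : ParamRep g v)
    (hv' : ParamRep g v') {δ : ℝ} (hδ : 0 < δ) :
    ∃ a : unitI → unitI, Continuous a ∧ Surjective a ∧ Monotone a ∧
      ∀ t, dist (v (a t)) (v' t) ≤ δ := by
  obtain ⟨ψ, hψ⟩ := exists_homeo g
  have key : ∀ {v : unitI → unitI × ℝ}, ParamRep g v → ∃ φ : unitI → unitI,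
      Continuous φ ∧ Surjective φ ∧ Monotone φ ∧ ∀ t, v t = ψ.symm (φ t) := by
    intro v hv
    refine ⟨fun t => ψ ⟨v t, hv.mem t⟩, ψ.continuous.comp (hv.1.subtype_mk _), ?_, ?_, ?_⟩
    · intro c
      have : (ψ.symm c : unitI × ℝ) ∈ range v := by
        rw [hv.2.1]; exact (ψ.symm c).2
      obtain ⟨t, ht⟩ := this
      refine ⟨t, ?_⟩
      have : (⟨v t, hv.mem t⟩ : Gamma g) = ψ.symm c := Subtype.ext ht
      simp [this]
    · intro s t h
      exact (hψ ⟨v s, hv.mem s⟩ ⟨v t, hv.mem t⟩).1 (hv.2.2 s t h)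
    · intro t; simp
  obtain ⟨φ, h1, h2, h3, h4⟩ := key hv
  obtain ⟨φ', h1', h2', h3', h4'⟩ := key hv'
  have huc : UniformContinuous (fun t => (ψ.symm t : unitI × ℝ)) :=
    CompactSpace.uniformContinuous_of_continuous
      (continuous_subtype_val.comp ψ.symm.continuous)
  obtain ⟨η, hη, hu⟩ := Metric.uniformContinuous_iff.1 huc δ hδ
  obtain ⟨b, b1, b2, b3, b4⟩ := reparam_aux h1 h2 h3 (ε := min (η / 2) (1 / 2))
    (by positivity) (lt_of_le_of_lt (min_le_right _ _) (by norm_num))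
  refine ⟨b ∘ φ', b1.comp h1', b2.comp h2', b3.comp h3', fun t => ?_⟩
  rw [h4, h4']
  refine (hu ?_).le
  have := b4 (φ' t)
  have h5 := min_le_left (η / 2) (1 / 2)
  rw [Subtype.dist_eq, Real.dist_eq]
  simp only [comp_apply]
  linarith

def costSet (f g : D) : Set ℝ := {x : ℝ | ∃ u v : unitI → unitI × ℝ, ParamRep f u ∧ ParamRep g v ∧
    x = (⨆ t : unitI, |((u t).1 : ℝ) - ((v t).1 : ℝ)|) +
      ⨆ t : unitI, |(u t).2 - (v t).2|}

lemma dM1_eq (f g : D) : dM1 f g = sInf (costSet f g) := rfl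

lemma costSet_nonempty (f g : D) : (costSet f g).Nonempty := by
  obtain ⟨u, hu⟩ := paramRep_exists f
  obtain ⟨v, hv⟩ := paramRep_exists g
  exact ⟨_, u, v, hu, hv, rfl⟩

lemma costSet_nonneg (f g : D) {x : ℝ} (hx : x ∈ costSet f g) : 0 ≤ x := by
  obtain ⟨u, v, -, -, rfl⟩ := hx
  exact add_nonneg (Real.iSup_nonneg fun _ => abs_nonneg _) (Real.iSup_nonneg fun _ => abs_nonneg _)

lemma costSet_bdd (f g : D) : BddBelow (costSet f g) := ⟨0, fun _ hx => costSet_nonneg f g hx⟩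

lemma bdd1 {u v : unitI → unitI × ℝ} (hu : Continuous u) (hv : Continuous v) :
    BddAbove (range fun t => |((u t).1 : ℝ) - ((v t).1 : ℝ)|) :=
  (isCompact_range (by fun_prop)).bddAbove

lemma bdd2 {u v : unitI → unitI × ℝ} (hu : Continuous u) (hv : Continuous v) :
    BddAbove (range fun t => |(u t).2 - (v t).2|) :=
  (isCompact_range (by fun_prop)).bddAbove

lemma dM1_nonneg (f g : D) : 0 ≤ dM1 f g := Real.sInf_nonneg fun _ hx => costSet_nonneg f g hx

lemma dM1_self (f : D) : dM1 f f = 0 := by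
  refine le_antisymm ?_ (dM1_nonneg f f)
  obtain ⟨u, hu⟩ := paramRep_exists f
  exact csInf_le (costSet_bdd f f) ⟨u, u, hu, hu, by simp⟩

lemma dM1_comm (f g : D) : dM1 f g = dM1 g f := by
  have : ∀ f g, costSet f g ⊆ costSet g f := by
    rintro f g x ⟨u, v, hu, hv, rfl⟩
    exact ⟨v, u, hv, hu, by simp only [abs_sub_comm]⟩
  rw [dM1_eq, dM1_eq, (this f g).antisymm (this g f)]

lemma dM1_triangle (f g h : D) : dM1 f h ≤ dM1 f g + dM1 g h := by
  refine le_of_forall_pos_le_add fun ε hε => ?_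
  obtain ⟨x, ⟨u, v, hu, hv, rfl⟩, hx⟩ := exists_lt_of_csInf_lt (costSet_nonempty f g)
    (show sInf (costSet f g) < dM1 f g + ε / 4 by rw [← dM1_eq]; linarith)
  obtain ⟨y, ⟨v', w, hv', hw, rfl⟩, hy⟩ := exists_lt_of_csInf_lt (costSet_nonempty g h)
    (show sInf (costSet g h) < dM1 g h + ε / 4 by rw [← dM1_eq]; linarith)
  obtain ⟨a, a1, a2, a3, a4⟩ := hv.approx hv' (δ := ε / 4) (by positivity)
  have hmem : dM1 f h ≤ _ := csInf_le (costSet_bdd f h)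
    ⟨fun t => u (a t), w, hu.comp a1 a2 a3, hw, rfl⟩
  have e1 : (⨆ t : unitI, |((u (a t)).1 : ℝ) - ((w t).1 : ℝ)|) ≤
      (⨆ t : unitI, |((u t).1 : ℝ) - ((v t).1 : ℝ)|) + ε / 4 +
      ⨆ t : unitI, |((v' t).1 : ℝ) - ((w t).1 : ℝ)| := by
    have : Nonempty unitI := ⟨i0⟩
    refine ciSup_le fun t => ?_
    have q1 := le_ciSup (bdd1 hu.1 hv.1) (a t)
    have q2 := le_ciSup (bdd1 hv'.1 hw.1) t
    have q3 : |((v (a t)).1 : ℝ) - ((v' t).1 : ℝ)| ≤ ε / 4 := by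
      have := (le_max_left _ _).trans (a4 t)
      exact this
    have q4 := abs_sub_le ((u (a t)).1 : ℝ) (v (a t)).1 (w t).1
    have q5 := abs_sub_le ((v (a t)).1 : ℝ) (v' t).1 (w t).1
    linarith
  have e2 : (⨆ t : unitI, |(u (a t)).2 - (w t).2|) ≤
      (⨆ t : unitI, |(u t).2 - (v t).2|) + ε / 4 +
      ⨆ t : unitI, |(v' t).2 - (w t).2| := by
    have : Nonempty unitI := ⟨i0⟩
    refine ciSup_le fun t => ?_
    have q1 := le_ciSup (bdd2 hu.1 hv.1) (a t)
    have q2 := le_ciSup (bdd2 hv'.1 hw.1) t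
    have q3 : |(v (a t)).2 - (v' t).2| ≤ ε / 4 := by
      have := (le_max_right _ _).trans (a4 t)
      exact this
    have q4 := abs_sub_le (u (a t)).2 (v (a t)).2 (w t).2
    have q5 := abs_sub_le (v (a t)).2 (v' t).2 (w t).2
    linarith
  linarith

lemma Gamma_subset {f g : D} (h : dM1 f g = 0) : Gamma f ⊆ Gamma g := by
  intro p hp
  rw [← (isCompact_Gamma g).isClosed.closure_eq, Metric.mem_closure_iff]
  intro ε hε
  obtain ⟨x, ⟨u, v, hu, hv, rfl⟩, hx⟩ := exists_lt_of_csInf_lt (costSet_nonempty f g)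
    (show sInf (costSet f g) < ε by rw [← dM1_eq, h]; exact hε)
  rw [← hu.2.1] at hp
  obtain ⟨t, rfl⟩ := hp
  refine ⟨v t, hv.mem t, ?_⟩
  have q1 := le_ciSup (bdd1 hu.1 hv.1) t
  have q2 := le_ciSup (bdd2 hu.1 hv.1) t
  have n1 := abs_nonneg ((u t).2 - (v t).2)
  have n2 := abs_nonneg (((u t).1 : ℝ) - (v t).1)
  rw [Prod.dist_eq, Subtype.dist_eq, Real.dist_eq, Real.dist_eq]
  exact max_lt (by linarith) (by linarith)

lemma eq_of_Gamma_subset {f g : D} (h : Gamma f ⊆ Gamma g) (h' : Gamma g ⊆ Gamma f) : f = g := by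
  have hlt : ∀ t : unitI, t < i1 → f.1 t = g.1 t := by
    intro t ht
    have hne : (𝓝[>] t).NeBot := nhdsGT_neBot_of_exists_gt ⟨i1, ht⟩
    have h1 : Tendsto (fun s => (s, g.1 s)) (𝓝[>] t) (map (fun s => (s, g.1 s)) (𝓝[>] t)) :=
      tendsto_map
    have h2 := tendsto_snd_aux f isOpen_Ioi t (f.2.1 t)
      (U := map (fun s => (s, g.1 s)) (𝓝[>] t))
      (eventually_map.2 (Eventually.of_forall fun s => h' (right_mem g s)))
      (tendsto_map'_iff.2 tendsto_id)
    exact tendsto_nhds_unique (tendsto_map'_iff.1 h2) (g.2.1 t)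
  have hleft : leftLim f.1 i1 = leftLim g.1 i1 := by
    have hne : (𝓝[<] i1).NeBot := nhdsLT_neBot_of_exists_lt ⟨i0, show (0:ℝ) < 1 by norm_num⟩
    refine tendsto_nhds_unique (tendsto_leftLim' f i1) ((tendsto_leftLim' g i1).congr' ?_)
    filter_upwards [self_mem_nhdsWithin] with s hs
    exact (hlt s hs).symm
  refine Subtype.ext (funext fun t => ?_)
  rcases (show t ≤ i1 from t.2.2).lt_or_eq with ht | rfl
  · exact hlt t ht
  · have m1 := h (right_mem f i1)
    have a1 := abs_fibre g m1
    have a2 := abs_fibre f (h' (right_mem g i1))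
    rw [hleft] at a2
    exact fibre_inj g m1 (right_mem g i1) (le_antisymm a1 a2)

/-- The Skorokhod `M₁` distance `d_{M1}` is a metric on `D`. -/
theorem dM1_is_metric :
    (∀ f g : D, 0 ≤ dM1 f g) ∧
    (∀ f g : D, dM1 f g = 0 ↔ f = g) ∧
    (∀ f g : D, dM1 f g = dM1 g f) ∧
    (∀ f g h : D, dM1 f h ≤ dM1 f g + dM1 g h) := by
  refine ⟨dM1_nonneg, fun f g => ⟨fun h => ?_, ?_⟩, dM1_comm, dM1_triangle⟩
  · exact eq_of_Gamma_subset (Gamma_subset h) (Gamma_subset (by rw [dM1_comm]; exact h))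
  · rintro rfl
    exact dM1_self f
end
end
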